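/- Weak transport cost inequality: suppose {E_{A_i}}_{i=1}^{n_A} are Davies conditional expectations on a lattice Λ with common full-rank invariant Gibbs state σ, each E_{A_i} acting nontrivially only on A_i∂, and suppose D(ρ‖σ) ≤ Σᵢ D(ρ‖E_{A_i}(ρ)) + c₂ for all states ρ. Then for all states ρ, ‖ρ − σ‖_{W₁} ≤ 2√2 · (max_i |A_i∂|) · √(n_A · D(ρ‖σ)) + |Λ| · √(2 c₂). -/

import Mathlib

open scoped BigOperators Matrix Classical ComplexOrder

noncomputable section

namespace Paper

variable {n : Type*} [Fintype n] [DecidableEq n]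

/-- Operator (spectral) norm of a matrix, via the Euclidean operator norm. -/
def opNorm (A : Matrix n n ℂ) : ℝ :=
  ‖LinearMap.toContinuousLinearMap (Matrix.toEuclideanLin A)‖

/-- Functional calculus on Hermitian matrices (returns `0` on non-Hermitian input). -/
def matFun (f : ℝ → ℝ) (A : Matrix n n ℂ) : Matrix n n ℂ :=
  if h : A.IsHermitian then
    (h.eigenvectorUnitary : Matrix n n ℂ) *
      Matrix.diagonal (fun i => (f (h.eigenvalues i) : ℂ)) *
      (star h.eigenvectorUnitary : Matrix n n ℂ)
  else 0

/-- Matrix logarithm (spectral). -/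
def matLog (A : Matrix n n ℂ) : Matrix n n ℂ := matFun Real.log A

/-- Matrix exponential (spectral, for Hermitian matrices). -/
def matExp (A : Matrix n n ℂ) : Matrix n n ℂ := matFun Real.exp A

/-- Trace norm (of a Hermitian matrix: the sum of absolute values of eigenvalues). -/
def traceNorm (A : Matrix n n ℂ) : ℝ :=
  if h : A.IsHermitian then ∑ i, |h.eigenvalues i| else 0

/-- Umegaki relative entropy `D(ρ‖σ) = Tr[ρ(log ρ − log σ)]`. -/
def relEnt (ρ σ : Matrix n n ℂ) : ℝ :=
  (Matrix.trace (ρ * (matLog ρ - matLog σ))).re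

/-- von Neumann entropy. -/
def vnEnt (ρ : Matrix n n ℂ) : ℝ := -(Matrix.trace (ρ * matLog ρ)).re

/-- A quantum state: positive semidefinite with unit trace. -/
def IsState (ρ : Matrix n n ℂ) : Prop := ρ.PosSemidef ∧ ρ.trace = 1

/-- Entropy production of a generator `L` with respect to the reference state `σ`. -/
def entProd (L : Matrix n n ℂ → Matrix n n ℂ) (σ ρ : Matrix n n ℂ) : ℝ :=
  -(Matrix.trace (L ρ * (matLog ρ - matLog σ))).re

end Paper
namespace Paper

variable {n : Type*} [Fintype n] [DecidableEq n]

/-- `F` is the Hilbert–Schmidt (Heisenberg) dual of the Schrödinger-picture map `E`. -/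
def IsDual (E F : Matrix n n ℂ →ₗ[ℂ] Matrix n n ℂ) : Prop :=
  ∀ X Y, Matrix.trace (E X * Y) = Matrix.trace (X * F Y)

/-- GNS symmetry of a (Heisenberg-picture) map `F` with respect to the state `σ`:
self-adjointness for the GNS inner product `⟨X, Y⟩ = Tr[X† σ Y]`. -/
def GNSSymmetric (σ : Matrix n n ℂ) (F : Matrix n n ℂ →ₗ[ℂ] Matrix n n ℂ) : Prop :=
  ∀ X Y, Matrix.trace (Xᴴ * σ * F Y) = Matrix.trace ((F X)ᴴ * σ * Y)

/-- `E` (Schrödinger picture, with Heisenberg dual `F`) is a conditional expectation onto a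
von Neumann subalgebra, GNS-symmetric with respect to the full-rank invariant state `σ`. -/
structure IsGNSCondExp (σ : Matrix n n ℂ) (E F : Matrix n n ℂ →ₗ[ℂ] Matrix n n ℂ) : Prop where
  dual : IsDual E F
  idem : ∀ X, E (E X) = E X
  pos : ∀ X, X.PosSemidef → (E X).PosSemidef
  tracePreserving : ∀ X, (E X).trace = X.trace
  unital : F 1 = 1
  bimodule : ∀ X Y Z, F (F X * Y * F Z) = F X * F Y * F Z
  invariant : E σ = σ
  gns : GNSSymmetric σ F

end Paper
namespace Paper

variable {ι : Type*} [Fintype ι] [DecidableEq ι] {d : ι → Type*}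
  [∀ i, Fintype (d i)] [∀ i, DecidableEq (d i)]

/-- Embedding `Id_i ⊗ H̃` of an operator `H̃` on the complement of the site `i` into the full
multipartite space. -/
def embedAt (i : ι) (M : Matrix (∀ j : {j : ι // j ≠ i}, d j.1) (∀ j : {j : ι // j ≠ i}, d j.1) ℂ) :
    Matrix (∀ j, d j) (∀ j, d j) ℂ :=
  fun x y => if x i = y i then M (fun j => x j.1) (fun j => y j.1) else 0

/-- The Lipschitz norm `‖H‖_L = 2 maxᵢ min_{H̃} ‖H − Id_i ⊗ H̃‖_∞` on a multipartite space. -/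
def lipNorm (H : Matrix (∀ j, d j) (∀ j, d j) ℂ) : ℝ :=
  2 * ⨆ i : ι, ⨅ M : Matrix (∀ j : {j : ι // j ≠ i}, d j.1) (∀ j : {j : ι // j ≠ i}, d j.1) ℂ,
    opNorm (H - embedAt i M)

/-- The quantum Wasserstein norm of order 1:
`‖X‖_{W₁} = max{Tr[H X] : H self-adjoint, ‖H‖_L ≤ 1}`. -/
def w1Norm (X : Matrix (∀ j, d j) (∀ j, d j) ℂ) : ℝ :=
  sSup {r : ℝ | ∃ H : Matrix (∀ j, d j) (∀ j, d j) ℂ,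
    H.IsHermitian ∧ lipNorm H ≤ 1 ∧ r = (Matrix.trace (H * X)).re}

/-- Partial trace over the sites in `J`, giving an operator on the complementary sites. -/
def ptraceSet (J : Finset ι) (X : Matrix (∀ j, d j) (∀ j, d j) ℂ) :
    Matrix (∀ j : {j : ι // j ∉ J}, d j.1) (∀ j : {j : ι // j ∉ J}, d j.1) ℂ :=
  fun x y => ∑ z : ∀ j : {j : ι // j ∈ J}, d j.1,
    X (fun j => if h : j ∈ J then z ⟨j, h⟩ else x ⟨j, h⟩)
      (fun j => if h : j ∈ J then z ⟨j, h⟩ else y ⟨j, h⟩)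

end Paper
namespace Paper

section Helpers
variable {n : Type*} [Fintype n] [DecidableEq n]

lemma log_lower {x : ℝ} (hx : 0 < x) :
    (x - 1) * (5 * x + 1) / (2 * x * (x + 2)) ≤ Real.log x := by
  set h : ℝ → ℝ := fun x => Real.log x - (x - 1) * (5 * x + 1) / (2 * x * (x + 2)) with hh
  have hder : ∀ y : ℝ, 0 < y → HasDerivAt h ((y - 1) ^ 3 / (y ^ 2 * (y + 2) ^ 2)) y := by
    intro y hy
    have h1 : HasDerivAt (fun x : ℝ => (x - 1) * (5 * x + 1))
        (1 * (5 * y + 1) + (y - 1) * (5 * 1)) y :=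
      ((hasDerivAt_id y).sub_const 1).mul (((hasDerivAt_id y).const_mul 5).add_const 1)
    have h2 : HasDerivAt (fun x : ℝ => 2 * x * (x + 2))
        ((2 * 1) * (y + 2) + (2 * y) * 1) y :=
      ((hasDerivAt_id y).const_mul 2).mul ((hasDerivAt_id y).add_const 2)
    have h3 := (Real.hasDerivAt_log hy.ne').sub (h1.div h2 (by positivity))
    convert! h3 using 1
    field_simp
    ring
  have h1 : h 1 = 0 := by simp [hh]
  have key : 0 ≤ h x := by
    rcases le_total x 1 with hx1 | hx1
    · have : AntitoneOn h (Set.Icc x 1) := by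
        apply antitoneOn_of_deriv_nonpos (convex_Icc _ _)
        · intro y hy
          exact (hder y (lt_of_lt_of_le hx hy.1)).continuousAt.continuousWithinAt
        · intro y hy
          rw [interior_Icc] at hy
          exact (hder y (hx.trans hy.1)).differentiableAt.differentiableWithinAt
        · intro y hy
          rw [interior_Icc] at hy
          rw [(hder y (hx.trans hy.1)).deriv]
          apply div_nonpos_of_nonpos_of_nonneg
          · have : (y-1)^3 = (y-1)*(y-1)^2 := by ring
            rw [this]
            exact mul_nonpos_of_nonpos_of_nonneg (by linarith [hy.2]) (sq_nonneg _)
          · positivity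
      rw [← h1]
      exact this ⟨le_refl _, hx1⟩ ⟨hx1, le_refl _⟩ hx1
    · have : MonotoneOn h (Set.Icc 1 x) := by
        apply monotoneOn_of_deriv_nonneg (convex_Icc _ _)
        · intro y hy
          exact (hder y (lt_of_lt_of_le one_pos hy.1)).continuousAt.continuousWithinAt
        · intro y hy
          rw [interior_Icc] at hy
          exact (hder y (one_pos.trans hy.1)).differentiableAt.differentiableWithinAt
        · intro y hy
          rw [interior_Icc] at hy
          rw [(hder y (one_pos.trans hy.1)).deriv]
          apply div_nonneg
          · exact pow_nonneg (by linarith [hy.1]) _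
          · positivity
      rw [← h1]
      exact this ⟨le_refl _, hx1⟩ ⟨hx1, le_refl _⟩ hx1
  simpa [hh] using key

/-- scalar Pinsker-type inequality -/
lemma scalar_pinsker {l m : ℝ} (hl : 0 ≤ l) (hm : 0 < m) :
    (l - m) ^ 2 / (l / 3 + 2 * m / 3) ≤ 2 * (l * Real.log l - l * Real.log m + (m - l)) := by
  rcases hl.eq_or_lt with rfl | hl
  · have : (0 - m) ^ 2 / (0 / 3 + 2 * m / 3) = 3 / 2 * m := by field_simp; ring
    rw [this]; simp; linarith
  · have h := log_lower (div_pos hl hm)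
    rw [Real.log_div hl.ne' hm.ne'] at h
    have h2 := mul_le_mul_of_nonneg_left h hl.le
    have e : l * ((l / m - 1) * (5 * (l / m) + 1) / (2 * (l / m) * (l / m + 2)))
        = (l - m) ^ 2 / (l / 3 + 2 * m / 3) / 2 + (l - m) := by
      field_simp; ring
    rw [e] at h2
    linarith

lemma spec_posSemidef {A : Matrix n n ℂ} (hA : A.PosSemidef) :
    ∃ (U : Matrix n n ℂ) (l : n → ℝ), Uᴴ * U = 1 ∧ U * Uᴴ = 1 ∧
      A = U * Matrix.diagonal (fun i => (l i : ℂ)) * Uᴴ ∧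
      matLog A = U * Matrix.diagonal (fun i => (Real.log (l i) : ℂ)) * Uᴴ ∧
      (∀ i, 0 ≤ l i) ∧ (A.PosDef → ∀ i, 0 < l i) := by
  have h := hA.isHermitian
  refine ⟨h.eigenvectorUnitary, h.eigenvalues, ?_, ?_, ?_, ?_, ?_, ?_⟩
  · exact Unitary.coe_star_mul_self h.eigenvectorUnitary
  · exact Unitary.coe_mul_star_self h.eigenvectorUnitary
  · exact h.spectral_theorem
  · rw [matLog, matFun, dif_pos h]; rfl
  · exact hA.eigenvalues_nonneg
  · intro hp; exact hp.eigenvalues_pos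

lemma trace_diag_form (U V K : Matrix n n ℂ) (f g : n → ℂ) :
    Matrix.trace (K * (U * Matrix.diagonal f * Uᴴ) * (V * Matrix.diagonal g * Vᴴ)) =
      ∑ i, ∑ j, f i * g j * ((Uᴴ * V) i j * (Vᴴ * K * U) j i) := by
  have : Matrix.trace (K * (U * Matrix.diagonal f * Uᴴ) * (V * Matrix.diagonal g * Vᴴ))
      = Matrix.trace ((Matrix.diagonal f * (Uᴴ * V)) * (Matrix.diagonal g * (Vᴴ * K * U))) := by
    have e : K * (U * Matrix.diagonal f * Uᴴ) * (V * Matrix.diagonal g * Vᴴ)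
      = (K * U) * (Matrix.diagonal f * (Uᴴ * V) * (Matrix.diagonal g * Vᴴ)) := by
      simp only [Matrix.mul_assoc]
    rw [e, Matrix.trace_mul_comm]
    simp only [Matrix.mul_assoc]
  rw [this]
  simp only [Matrix.trace, Matrix.diag, Matrix.mul_apply (M := Matrix.diagonal f * (Uᴴ * V)),
    Matrix.diagonal_mul]
  refine Finset.sum_congr rfl fun i _ => Finset.sum_congr rfl fun j _ => ?_
  ring

lemma star_entry (U V : Matrix n n ℂ) (i j : n) :
    (Vᴴ * U) j i = star ((Uᴴ * V) i j) := by
  rw [← Matrix.conjTranspose_apply, Matrix.conjTranspose_mul, Matrix.conjTranspose_conjTranspose]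

section
open scoped Matrix.Norms.L2Operator

lemma opNorm_eq (A : Matrix n n ℂ) : opNorm A = ‖A‖ := rfl

lemma col_bound (A : Matrix n n ℂ) (i : n) : ∑ j, ‖A j i‖ ^ 2 ≤ ‖A‖ ^ 2 := by
  have h := Matrix.l2_opNorm_mulVec A (EuclideanSpace.single i (1 : ℂ))
  have h2 := pow_le_pow_left₀ (norm_nonneg _) h 2
  rw [EuclideanSpace.norm_sq_eq] at h2
  simpa using h2

lemma row_bound (A : Matrix n n ℂ) (j : n) : ∑ i, ‖A j i‖ ^ 2 ≤ ‖A‖ ^ 2 := by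
  have := col_bound Aᴴ j
  rw [Matrix.l2_opNorm_conjTranspose] at this
  simpa using this

lemma norm_conj_le {U V : Matrix n n ℂ} (hU : Uᴴ * U = 1) (hV : V * Vᴴ = 1) (K : Matrix n n ℂ) :
    ‖Vᴴ * K * U‖ ≤ ‖K‖ := by
  have aux : ∀ W : Matrix n n ℂ, Wᴴ * W = 1 → ‖W‖ ≤ 1 := by
    intro W hW
    have := Matrix.l2_opNorm_conjTranspose_mul_self W
    rw [hW] at this
    have h1 : ‖(1 : Matrix n n ℂ)‖ ≤ 1 := by
      rw [← Matrix.diagonal_one, Matrix.l2_opNorm_diagonal]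
      refine (pi_norm_le_iff_of_nonneg zero_le_one).2 fun i => ?_
      simp
    nlinarith [norm_nonneg W]
  have h1 := aux U hU
  have h2 := aux Vᴴ (by simpa using hV)
  calc ‖Vᴴ * K * U‖ ≤ ‖Vᴴ‖ * ‖K‖ * ‖U‖ :=
        (Matrix.l2_opNorm_mul _ _).trans (by gcongr; exact Matrix.l2_opNorm_mul _ _)
    _ ≤ 1 * ‖K‖ * 1 := by gcongr
    _ = ‖K‖ := by ring

lemma pinsker_aux {ρ τ : Matrix n n ℂ} (hρ : IsState ρ) (hτ : IsState τ) (hp : τ.PosDef)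
    (K : Matrix n n ℂ) :
    ‖Matrix.trace (K * (ρ - τ))‖ ^ 2 ≤ ‖K‖ ^ 2 * (2 * relEnt ρ τ) ∧ 0 ≤ relEnt ρ τ := by
  obtain ⟨U, l, hU, hU', eρ, lρ, hl, -⟩ := spec_posSemidef hρ.1
  obtain ⟨V, m, hV, hV', eτ, lτ, -, hm⟩ := spec_posSemidef hτ.1
  replace hm := hm hp
  set O := Uᴴ * V with hO
  set K' := Vᴴ * K * U with hK'
  have oneU : U * Matrix.diagonal (fun _ => (1 : ℂ)) * Uᴴ = 1 := by
    rw [Matrix.diagonal_one, Matrix.mul_one, hU']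
  have oneV : V * Matrix.diagonal (fun _ => (1 : ℂ)) * Vᴴ = 1 := by
    rw [Matrix.diagonal_one, Matrix.mul_one, hV']
  have form1 : ∀ f g : n → ℝ, Matrix.trace ((U * Matrix.diagonal (fun i => (f i : ℂ)) * Uᴴ) *
      (V * Matrix.diagonal (fun i => (g i : ℂ)) * Vᴴ)) =
      ((∑ i, ∑ j, f i * g j * ‖O i j‖ ^ 2 : ℝ) : ℂ) := by
    intro f g
    have := trace_diag_form U V 1 (fun i => (f i : ℂ)) (fun i => (g i : ℂ))
    rw [Matrix.one_mul, Matrix.mul_one] at this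
    rw [this]
    push_cast
    refine Finset.sum_congr rfl fun i _ => Finset.sum_congr rfl fun j _ => ?_
    rw [star_entry U V i j, ← hO, ← Complex.mul_conj']
    rfl
  have hent : relEnt ρ τ = ∑ i, ∑ j, (l i * Real.log (l i) - l i * Real.log (m j)) * ‖O i j‖ ^ 2 := by
    have e1 : Matrix.trace (ρ * matLog ρ) =
        ((∑ i, ∑ j, (l i * Real.log (l i)) * 1 * ‖O i j‖ ^ 2 : ℝ) : ℂ) := by
      rw [← form1 (fun i => l i * Real.log (l i)) (fun _ => 1)]
      simp only [Complex.ofReal_one]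
      rw [oneV, Matrix.mul_one, lρ]
      conv_lhs => rw [eρ]
      congr 1
      have : ∀ D D' : Matrix n n ℂ, U * D * Uᴴ * (U * D' * Uᴴ) = U * (D * D') * Uᴴ := by
        intro D D'
        calc _ = U * D * (Uᴴ * U) * D' * Uᴴ := by simp only [Matrix.mul_assoc]
          _ = _ := by rw [hU, Matrix.mul_one]; simp only [Matrix.mul_assoc]
      rw [this, Matrix.diagonal_mul_diagonal]
      push_cast
      rfl
    have e2 : Matrix.trace (ρ * matLog τ) =
        ((∑ i, ∑ j, l i * Real.log (m j) * ‖O i j‖ ^ 2 : ℝ) : ℂ) := by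
      rw [← form1 l (fun j => Real.log (m j)), lτ]
      conv_lhs => rw [eρ]
    rw [relEnt, Matrix.mul_sub, Matrix.trace_sub, e1, e2, ← Complex.ofReal_sub, Complex.ofReal_re,
      ← Finset.sum_sub_distrib]
    refine Finset.sum_congr rfl fun i _ => ?_
    rw [← Finset.sum_sub_distrib]
    refine Finset.sum_congr rfl fun j _ => ?_
    ring
  have htr : ∑ i, ∑ j, (m j - l i) * ‖O i j‖ ^ 2 = 0 := by
    have e1 : Matrix.trace ρ = ((∑ i, ∑ j, l i * 1 * ‖O i j‖ ^ 2 : ℝ) : ℂ) := by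
      rw [← form1 l (fun _ => 1)]
      simp only [Complex.ofReal_one]
      rw [oneV, Matrix.mul_one, ← eρ]
    have e2 : Matrix.trace τ = ((∑ i, ∑ j, 1 * m j * ‖O i j‖ ^ 2 : ℝ) : ℂ) := by
      rw [← form1 (fun _ => 1) m]
      simp only [Complex.ofReal_one]
      rw [oneU, Matrix.one_mul, ← eτ]
    rw [hρ.2] at e1
    rw [hτ.2] at e2
    have e3 := e2.symm.trans e1
    have e4 := Complex.ofReal_injective e3
    rw [← sub_eq_zero, ← Finset.sum_sub_distrib] at e4
    rw [← e4]
    refine Finset.sum_congr rfl fun i _ => ?_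
    rw [← Finset.sum_sub_distrib]
    refine Finset.sum_congr rfl fun j _ => ?_
    ring
  have hent2 : 2 * relEnt ρ τ = ∑ i, ∑ j,
      2 * (l i * Real.log (l i) - l i * Real.log (m j) + (m j - l i)) * ‖O i j‖ ^ 2 := by
    rw [← add_zero (relEnt ρ τ), ← htr, hent, ← Finset.sum_add_distrib, Finset.mul_sum]
    refine Finset.sum_congr rfl fun i _ => ?_
    rw [← Finset.sum_add_distrib, Finset.mul_sum]
    refine Finset.sum_congr rfl fun j _ => ?_
    ring
  set w : n → n → ℝ := fun i j => l i / 3 + 2 * m j / 3 with hw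
  have hwpos : ∀ i j, 0 < w i j := fun i j => by
    have := hl i; have := hm j; simp only [hw]; positivity
  have hent3 : ∑ i, ∑ j, ((l i - m j) ^ 2 / w i j) * ‖O i j‖ ^ 2 ≤ 2 * relEnt ρ τ := by
    rw [hent2]
    gcongr with i _ j _
    exact scalar_pinsker (hl i) (hm j)
  have hnn : 0 ≤ ∑ i, ∑ j, ((l i - m j) ^ 2 / w i j) * ‖O i j‖ ^ 2 := by
    refine Finset.sum_nonneg fun i _ => Finset.sum_nonneg fun j _ => ?_
    have := hwpos i j
    positivity
  refine ⟨?_, by linarith⟩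
  have hK : Matrix.trace (K * (ρ - τ)) = ∑ i, ∑ j, ((l i : ℂ) - m j) * (O i j * K' j i) := by
    have e1 := trace_diag_form U V K (fun i => (l i : ℂ)) (fun _ => 1)
    rw [oneV, Matrix.mul_one, ← eρ] at e1
    have e2 := trace_diag_form U V K (fun _ => 1) (fun i => (m i : ℂ))
    rw [oneU, Matrix.mul_one, ← eτ] at e2
    rw [Matrix.mul_sub, Matrix.trace_sub, e1, e2, ← Finset.sum_sub_distrib]
    refine Finset.sum_congr rfl fun i _ => ?_
    rw [← Finset.sum_sub_distrib]
    refine Finset.sum_congr rfl fun j _ => ?_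
    ring
  have hK2 : ‖Matrix.trace (K * (ρ - τ))‖ ≤ ∑ p : n × n, (|l p.1 - m p.2| / √(w p.1 p.2) * ‖O p.1 p.2‖) *
      (√(w p.1 p.2) * ‖K' p.2 p.1‖) := by
    rw [hK, Fintype.sum_prod_type]
    refine (norm_sum_le _ _).trans (Finset.sum_le_sum fun i _ => ?_)
    refine (norm_sum_le _ _).trans (Finset.sum_le_sum fun j _ => ?_)
    rw [norm_mul, norm_mul, ← Complex.ofReal_sub, Complex.norm_real, Real.norm_eq_abs]
    have := Real.sqrt_pos.2 (hwpos i j)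
    apply le_of_eq
    field_simp
  have hB : ∑ p : n × n, (√(w p.1 p.2) * ‖K' p.2 p.1‖) ^ 2 ≤ ‖K‖ ^ 2 := by
    have hKK : ‖K'‖ ^ 2 ≤ ‖K‖ ^ 2 := by
      gcongr
      exact norm_conj_le hU hV' K
    have sl : ∑ i, l i = 1 := by
      have := hρ.2
      rw [eρ, Matrix.trace_mul_comm, ← Matrix.mul_assoc, hU, Matrix.one_mul,
        Matrix.trace_diagonal] at this
      exact_mod_cast this
    have sm : ∑ i, m i = 1 := by
      have := hτ.2
      rw [eτ, Matrix.trace_mul_comm, ← Matrix.mul_assoc, hV, Matrix.one_mul,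
        Matrix.trace_diagonal] at this
      exact_mod_cast this
    have e : ∑ p : n × n, (√(w p.1 p.2) * ‖K' p.2 p.1‖) ^ 2 =
        ∑ i, l i / 3 * ∑ j, ‖K' j i‖ ^ 2 + ∑ j, 2 * m j / 3 * ∑ i, ‖K' j i‖ ^ 2 := by
      simp_rw [Finset.mul_sum]
      rw [Finset.sum_comm (f := fun j i => 2 * m j / 3 * ‖K' j i‖ ^ 2), Fintype.sum_prod_type,
        ← Finset.sum_add_distrib]
      refine Finset.sum_congr rfl fun i _ => ?_
      rw [← Finset.sum_add_distrib]
      refine Finset.sum_congr rfl fun j _ => ?_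
      rw [mul_pow, Real.sq_sqrt (hwpos i j).le]
      simp only [hw]; ring
    rw [e]
    calc _ ≤ ∑ i, l i / 3 * ‖K'‖ ^ 2 + ∑ j, 2 * m j / 3 * ‖K'‖ ^ 2 := by
          gcongr with i _ j _
          · exact div_nonneg (hl i) (by norm_num)
          · exact col_bound _ _
          · have := hm j; positivity
          · exact row_bound _ _
      _ = ‖K'‖ ^ 2 := by
          rw [← Finset.sum_mul, ← Finset.sum_mul, ← Finset.sum_div, ← Finset.sum_div,
            ← Finset.mul_sum, sl, sm]; ring
      _ ≤ _ := hKK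
  have hA : ∑ p : n × n, (|l p.1 - m p.2| / √(w p.1 p.2) * ‖O p.1 p.2‖) ^ 2 ≤ 2 * relEnt ρ τ := by
    refine le_trans (le_of_eq ?_) hent3
    rw [Fintype.sum_prod_type]
    refine Finset.sum_congr rfl fun i _ => Finset.sum_congr rfl fun j _ => ?_
    rw [mul_pow, div_pow, Real.sq_sqrt (hwpos i j).le, sq_abs]
  calc _ ≤ (∑ p : n × n, (|l p.1 - m p.2| / √(w p.1 p.2) * ‖O p.1 p.2‖) *
      (√(w p.1 p.2) * ‖K' p.2 p.1‖)) ^ 2 := by gcongr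
    _ ≤ _ := Finset.sum_mul_sq_le_sq_mul_sq _ _ _
    _ ≤ (2 * relEnt ρ τ) * ‖K‖ ^ 2 := by
        gcongr
        exact hnn.trans hent3
    _ = _ := by ring

end

lemma relEnt_nonneg {ρ τ : Matrix n n ℂ} (hρ : IsState ρ) (hτ : IsState τ) (hp : τ.PosDef) :
    0 ≤ relEnt ρ τ := (pinsker_aux hρ hτ hp 0).2

lemma pinsker {ρ τ : Matrix n n ℂ} (hρ : IsState ρ) (hτ : IsState τ) (hp : τ.PosDef)
    (K : Matrix n n ℂ) {c : ℝ} (hK : opNorm K ≤ c) :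
    |(Matrix.trace (K * (ρ - τ))).re| ≤ c * √(2 * relEnt ρ τ) := by
  have h0 : 0 ≤ opNorm K := norm_nonneg _
  have h1 := (pinsker_aux hρ hτ hp K).1
  have h2 := (pinsker_aux hρ hτ hp K).2
  rw [← opNorm_eq] at h1
  refine (Complex.abs_re_le_norm _).trans ?_
  refine le_trans (abs_le_of_sq_le_sq' (b := opNorm K * √(2 * relEnt ρ τ)) ?_ (by positivity)).2 (by gcongr)
  rw [mul_pow, Real.sq_sqrt (by positivity)]
  exact h1

lemma posDef_dominates {ρ σ : Matrix n n ℂ} (hρ : ρ.PosDef) (hσ : σ.PosSemidef) :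
    ∃ c : ℝ, 0 < c ∧ (ρ - (c : ℂ) • σ).PosSemidef := by
  obtain ⟨U, l, hU, hU', eρ, -, -, hl⟩ := spec_posSemidef hρ.posSemidef
  obtain ⟨V, s, hV, hV', eσ, -, hs, -⟩ := spec_posSemidef hσ
  replace hl := hl hρ
  set A : ℝ := 1 + ∑ i, (l i)⁻¹ with hA
  set B : ℝ := 1 + ∑ i, s i with hB
  have hAi : ∀ i, (l i)⁻¹ ≤ A := fun i => by
    have := Finset.single_le_sum (f := fun i => (l i)⁻¹) (fun i _ => (inv_pos.2 (hl i)).le)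
      (Finset.mem_univ i)
    linarith
  have hBi : ∀ i, s i ≤ B := fun i => by
    have := Finset.single_le_sum (f := fun i => s i) (fun i _ => hs i) (Finset.mem_univ i)
    linarith
  have hA0 : 0 < A := by
    have : 0 ≤ ∑ i, (l i)⁻¹ := Finset.sum_nonneg fun i _ => (inv_pos.2 (hl i)).le
    linarith
  have hB0 : 0 < B := by
    have : 0 ≤ ∑ i, s i := Finset.sum_nonneg fun i _ => hs i
    linarith
  have gen : ∀ (U : Matrix n n ℂ) (f : n → ℝ), (∀ i, 0 ≤ f i) →
      (U * Matrix.diagonal (fun i => (f i : ℂ)) * Uᴴ).PosSemidef := by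
    intro U f hf
    apply Matrix.PosSemidef.mul_mul_conjTranspose_same
    rw [Matrix.posSemidef_diagonal_iff]
    intro i
    exact_mod_cast hf i
  have g1 := gen U (fun i => l i - A⁻¹) (fun i => by
    have := inv_le_of_inv_le₀ (hl i) (hAi i); linarith)
  have g2 := gen V (fun i => A⁻¹ * (1 - B⁻¹ * s i)) (fun i => by
    have h1 : B⁻¹ * s i ≤ B⁻¹ * B := by
      have := hBi i; gcongr
    rw [inv_mul_cancel₀ hB0.ne'] at h1
    exact mul_nonneg (by positivity) (by linarith))
  refine ⟨A⁻¹ * B⁻¹, by positivity, ?_⟩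
  convert g1.add g2 using 1
  have d1 : Matrix.diagonal (fun i => ((l i - A⁻¹ : ℝ) : ℂ)) =
      Matrix.diagonal (fun i => (l i : ℂ)) - ((A⁻¹ : ℝ) : ℂ) • (1 : Matrix n n ℂ) := by
    rw [← Matrix.diagonal_one, ← Matrix.diagonal_smul, Matrix.diagonal_sub]
    congr 1; funext i; simp
  have d2 : Matrix.diagonal (fun i => ((A⁻¹ * (1 - B⁻¹ * s i) : ℝ) : ℂ)) =
      ((A⁻¹ : ℝ) : ℂ) • (1 : Matrix n n ℂ) -
        ((A⁻¹ * B⁻¹ : ℝ) : ℂ) • Matrix.diagonal (fun i => (s i : ℂ)) := by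
    rw [← Matrix.diagonal_one, ← Matrix.diagonal_smul, ← Matrix.diagonal_smul, Matrix.diagonal_sub]
    congr 1; funext i; simp; ring
  rw [d1, d2]
  simp only [Matrix.mul_sub, Matrix.sub_mul, Matrix.mul_smul, Matrix.smul_mul, Matrix.mul_one,
    hU', hV', ← eρ, ← eσ]
  abel

section CondExp
variable {σ : Matrix n n ℂ} {E F : Matrix n n ℂ →ₗ[ℂ] Matrix n n ℂ}

lemma E_conjTranspose (hE : IsGNSCondExp σ E F) (X : Matrix n n ℂ) : E Xᴴ = (E X)ᴴ := by
  have herm : ∀ A : Matrix n n ℂ, Aᴴ = A → (E A)ᴴ = E A := by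
    intro A hA
    have h1 := (hE.pos _ (Matrix.posSemidef_conjTranspose_mul_self (A + 1))).isHermitian
    have h2 := (hE.pos _ (Matrix.posSemidef_conjTranspose_mul_self (A - 1))).isHermitian
    have e : A = (1 / 4 : ℝ) • ((A + 1)ᴴ * (A + 1) - (A - 1)ᴴ * (A - 1)) := by
      simp only [Matrix.conjTranspose_add, Matrix.conjTranspose_sub, Matrix.conjTranspose_one, hA]
      have : (A + 1) * (A + 1) - (A - 1) * (A - 1) = (4 : ℝ) • A := by
        have : (4 : ℝ) • A = A + A + A + A := by module
        rw [this]; noncomm_ring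
      rw [this, smul_smul]; norm_num
    have e2 : E A = (1 / 4 : ℂ) • (E ((A + 1)ᴴ * (A + 1)) - E ((A - 1)ᴴ * (A - 1))) := by
      conv_lhs => rw [e]
      rw [← map_sub, ← map_smul]
      congr 1
      ext i j
      simp [Complex.real_smul]
    rw [e2, Matrix.conjTranspose_smul, Matrix.conjTranspose_sub, h1, h2]
    simp
  have hX : X = (1 / 2 : ℂ) • (X + Xᴴ) + (-Complex.I / 2) • (Complex.I • (X - Xᴴ)) := by
    rw [smul_smul]
    have : -Complex.I / 2 * Complex.I = 1 / 2 := by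
      rw [div_mul_eq_mul_div, neg_mul, Complex.I_mul_I, neg_neg]
    rw [this]; module
  have hX' : Xᴴ = (1 / 2 : ℂ) • (X + Xᴴ) + (Complex.I / 2) • (Complex.I • (X - Xᴴ)) := by
    rw [smul_smul]
    have : Complex.I / 2 * Complex.I = -(1 / 2) := by
      rw [div_mul_eq_mul_div, Complex.I_mul_I]; ring
    rw [this]; module
  have a1 := herm (X + Xᴴ) (by simp [add_comm])
  have a2 := herm (Complex.I • (X - Xᴴ)) (by
    simp only [Matrix.conjTranspose_smul, Matrix.conjTranspose_sub,
      Matrix.conjTranspose_conjTranspose, RCLike.star_def, Complex.conj_I]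
    module)
  generalize X + Xᴴ = A at *
  generalize Complex.I • (X - Xᴴ) = B at *
  rw [hX', hX]
  simp only [map_add, map_smul, Matrix.conjTranspose_add, Matrix.conjTranspose_smul, a1, a2]
  simp

lemma F_conjTranspose (hE : IsGNSCondExp σ E F) (Y : Matrix n n ℂ) : F Yᴴ = (F Y)ᴴ := by
  rw [Matrix.ext_iff_trace_mul_left]
  intro X
  rw [← hE.dual X Yᴴ]
  have h := hE.dual Xᴴ Y
  have h2 := congrArg star h
  rw [← Matrix.trace_conjTranspose, ← Matrix.trace_conjTranspose, Matrix.conjTranspose_mul,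
    Matrix.conjTranspose_mul, Matrix.conjTranspose_conjTranspose, E_conjTranspose hE,
    Matrix.conjTranspose_conjTranspose, Matrix.trace_mul_comm] at h2
  rw [h2, Matrix.trace_mul_comm]

lemma E_mul_right (hE : IsGNSCondExp σ E F) (X : Matrix n n ℂ) : E (X * σ) = F X * σ := by
  rw [Matrix.ext_iff_trace_mul_right]
  intro Y
  rw [hE.dual]
  have := hE.gns Xᴴ Y
  rw [F_conjTranspose hE] at this
  simpa using this

lemma E_mul_left (hE : IsGNSCondExp σ E F) (hσ : σ.IsHermitian) (X : Matrix n n ℂ) :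
    E (σ * X) = σ * F X := by
  have := congrArg Matrix.conjTranspose (E_mul_right hE Xᴴ)
  rw [← E_conjTranspose hE, Matrix.conjTranspose_mul, Matrix.conjTranspose_mul, hσ.eq,
    F_conjTranspose hE] at this
  simpa using this

lemma F_mul_fixed (hE : IsGNSCondExp σ E F) {X Y : Matrix n n ℂ} (hX : F X = X) (hY : F Y = Y) :
    F (X * Y) = X * Y := by
  have := hE.bimodule X 1 Y
  rw [hX, hY, hE.unital] at this
  simpa using this

lemma F_idem (hE : IsGNSCondExp σ E F) (X : Matrix n n ℂ) : F (F X) = F X := by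
  have := hE.bimodule X 1 1
  rw [hE.unital] at this
  simpa using this

lemma F_modular (hE : IsGNSCondExp σ E F) (hp : σ.PosDef) {Y : Matrix n n ℂ} (hY : F Y = Y) :
    F (σ * Y * σ⁻¹) = σ * Y * σ⁻¹ := by
  have hu : IsUnit σ.det := (Matrix.isUnit_iff_isUnit_det _).1 hp.isUnit
  have h1 := E_mul_right hE (σ * Y * σ⁻¹)
  rw [Matrix.nonsing_inv_mul_cancel_right _ _ hu, E_mul_left hE hp.isHermitian, hY] at h1
  rw [h1, Matrix.mul_nonsing_inv_cancel_right _ _ hu]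
  exact F_idem hE _

lemma F_powers (hE : IsGNSCondExp σ E F) (hp : σ.PosDef) (ρ : Matrix n n ℂ) (k : ℕ) :
    F ((E ρ) ^ k * σ⁻¹ ^ k) = (E ρ) ^ k * σ⁻¹ ^ k := by
  have hu : IsUnit σ.det := (Matrix.isUnit_iff_isUnit_det _).1 hp.isUnit
  have h1 := E_mul_right hE (ρ * σ⁻¹)
  rw [Matrix.nonsing_inv_mul_cancel_right _ _ hu] at h1
  induction k with
  | zero => simpa using hE.unital
  | succ k ih =>
    have : E ρ ^ (k + 1) * σ⁻¹ ^ (k + 1) = F (ρ * σ⁻¹) * (σ * (E ρ ^ k * σ⁻¹ ^ k) * σ⁻¹) := by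
      rw [pow_succ', pow_succ]
      conv_lhs => rw [h1]
      rw [h1]
      simp only [Matrix.mul_assoc]
    rw [this]
    exact F_mul_fixed hE (F_idem hE _) (F_modular hE hp ih)

lemma E_posDef (hE : IsGNSCondExp σ E F) (hp : σ.PosDef) {ρ : Matrix n n ℂ} (hρ : ρ.PosDef) :
    (E ρ).PosDef := by
  obtain ⟨c, hc, h⟩ : ∃ c : ℝ, 0 < c ∧ (ρ - (c : ℂ) • σ).PosSemidef :=
    posDef_dominates hρ hp.posSemidef
  have h2 := hE.pos _ h
  rw [map_sub, map_smul, hE.invariant] at h2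
  have h3 : ((c : ℂ) • σ).PosDef := hp.smul (by exact_mod_cast hc)
  have := h3.add_posSemidef h2
  simpa using this

lemma F_log (hE : IsGNSCondExp σ E F) (hp : σ.PosDef) {ρ : Matrix n n ℂ} (hρ : ρ.PosDef) :
    F (matLog (E ρ) - matLog σ) = matLog (E ρ) - matLog σ := by
  have hω := E_posDef hE hp hρ
  obtain ⟨U, w, hU, hU', eω, lω, -, hw⟩ := spec_posSemidef hω.posSemidef
  obtain ⟨V, s, hV, hV', eσ, lσ, -, hs⟩ := spec_posSemidef hp.posSemidef
  replace hw := hw hω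
  replace hs := hs hp
  -- interpolating polynomial
  set S : Finset ℝ := Finset.univ.image (fun q : n × n => w q.1 / s q.2) with hS
  set P : Polynomial ℝ := Lagrange.interpolate S id Real.log with hP
  have hPe : ∀ a b, P.eval (w a / s b) = Real.log (w a) - Real.log (s b) := by
    intro a b
    have := Lagrange.eval_interpolate_at_node (s := S) (v := id) Real.log
      (Set.injOn_id _) (i := w a / s b) (by rw [hS]; exact Finset.mem_image.2 ⟨(a, b), by simp, rfl⟩)
    rw [id] at this
    rw [hP, this, Real.log_div (hw a).ne' (hs b).ne']
  have hpow : ∀ (U : Matrix n n ℂ) (D : Matrix n n ℂ), Uᴴ * U = 1 → U * Uᴴ = 1 → ∀ k : ℕ,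
      (U * D * Uᴴ) ^ k = U * D ^ k * Uᴴ := by
    intro U D h h' k
    induction k with
    | zero => simp [h']
    | succ k ih =>
      rw [pow_succ, ih, pow_succ]
      calc _ = U * D ^ k * (Uᴴ * U) * D * Uᴴ := by simp only [Matrix.mul_assoc]
        _ = _ := by rw [h, Matrix.mul_one]; simp only [Matrix.mul_assoc]
  have hinv : σ⁻¹ = V * Matrix.diagonal (fun i => ((s i)⁻¹ : ℂ)) * Vᴴ := by
    apply Matrix.inv_eq_right_inv
    rw [eσ]
    calc _ = V * (Matrix.diagonal (fun i => (s i : ℂ)) * (Vᴴ * V) * Matrix.diagonal (fun i => ((s i)⁻¹ : ℂ))) * Vᴴ := by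
          simp only [Matrix.mul_assoc]
      _ = V * Vᴴ := by
          rw [hV, Matrix.mul_one, Matrix.diagonal_mul_diagonal]
          have : (fun i => (s i : ℂ) * (s i : ℂ)⁻¹) = fun _ => 1 := by
            funext i
            have : (s i : ℂ) ≠ 0 := by exact_mod_cast (hs i).ne'
            field_simp
          rw [this, Matrix.diagonal_one, Matrix.mul_one]
      _ = 1 := hV'
  have key : matLog (E ρ) - matLog σ =
      ∑ k ∈ P.support, (P.coeff k : ℂ) • ((E ρ) ^ k * σ⁻¹ ^ k) := by
    have inj : ∀ A B : Matrix n n ℂ, Uᴴ * A * V = Uᴴ * B * V → A = B := by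
      intro A B h
      have := congrArg (fun M => U * M * Vᴴ) h
      simp only [Matrix.mul_assoc] at this
      simp only [hV', Matrix.mul_one] at this
      simpa only [← Matrix.mul_assoc, hU', Matrix.one_mul] using this
    apply inj
    have t1 : Uᴴ * (matLog (E ρ) - matLog σ) * V =
        Matrix.diagonal (fun i => (Real.log (w i) : ℂ)) * (Uᴴ * V) -
          (Uᴴ * V) * Matrix.diagonal (fun i => (Real.log (s i) : ℂ)) := by
      rw [lω, lσ, Matrix.mul_sub, Matrix.sub_mul]
      congr 1
      · simp only [← Matrix.mul_assoc, hU, Matrix.one_mul]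
      · simp only [Matrix.mul_assoc, hV, Matrix.mul_one]
    have t2 : ∀ k : ℕ, Uᴴ * ((E ρ) ^ k * σ⁻¹ ^ k) * V =
        Matrix.diagonal (fun i => (w i : ℂ) ^ k) * (Uᴴ * V) *
          Matrix.diagonal (fun i => (s i : ℂ)⁻¹ ^ k) := by
      intro k
      rw [hinv, hpow V _ hV hV']
      conv_lhs => rw [eω]
      rw [hpow U _ hU hU', Matrix.diagonal_pow, Matrix.diagonal_pow]
      calc _ = (Uᴴ * U) * Matrix.diagonal ((fun i => (w i : ℂ)) ^ k) * (Uᴴ * V) *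
          Matrix.diagonal ((fun i => (s i : ℂ)⁻¹) ^ k) * (Vᴴ * V) := by
            simp only [Matrix.mul_assoc]
        _ = _ := by rw [hU, hV, Matrix.one_mul, Matrix.mul_one]; rfl
    rw [t1, Finset.mul_sum, Finset.sum_mul]
    simp only [Matrix.mul_smul, Matrix.smul_mul, t2]
    ext a b
    rw [Matrix.sub_apply, Matrix.diagonal_mul, Matrix.mul_diagonal, Matrix.sum_apply]
    simp only [Matrix.smul_apply, Matrix.mul_diagonal, Matrix.diagonal_mul, smul_eq_mul]
    have hh := hPe a b
    rw [Polynomial.eval_eq_sum, Polynomial.sum] at hh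
    have hh' := congrArg (fun x : ℝ => (x : ℂ)) hh
    push_cast at hh'
    calc _ = ((Real.log (w a) : ℂ) - Real.log (s b)) * (Uᴴ * V) a b := by ring
      _ = _ := by
        rw [← hh', Finset.sum_mul]
        refine Finset.sum_congr rfl fun k _ => ?_
        rw [div_pow, inv_pow]; ring
  rw [key, map_sum]
  refine Finset.sum_congr rfl fun k _ => ?_
  rw [map_smul, F_powers hE hp]

lemma relEnt_chain (hE : IsGNSCondExp σ E F) (hp : σ.PosDef) {ρ : Matrix n n ℂ} (hρ : ρ.PosDef) :
    relEnt ρ σ = relEnt ρ (E ρ) + relEnt (E ρ) σ := by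
  have h := hE.dual ρ (matLog (E ρ) - matLog σ)
  rw [F_log hE hp hρ] at h
  unfold relEnt
  rw [h, ← Complex.add_re, ← Matrix.trace_add, ← Matrix.mul_add]
  congr 3
  abel

end CondExp

lemma relEnt_convex {ρ₀ ρ₁ σ : Matrix n n ℂ} (h0 : IsState ρ₀) (h1 : IsState ρ₁)
    (hp1 : ρ₁.PosDef) {t : ℝ} (ht : 0 < t) (ht1 : t ≤ 1) :
    ∃ τ : Matrix n n ℂ, τ = ρ₀ + (t : ℂ) • (ρ₁ - ρ₀) ∧ IsState τ ∧ τ.PosDef ∧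
      relEnt τ σ ≤ (1 - t) * relEnt ρ₀ σ + t * relEnt ρ₁ σ := by
  have e : ρ₀ + (t : ℂ) • (ρ₁ - ρ₀) = ((1 - t : ℝ) : ℂ) • ρ₀ + (t : ℂ) • ρ₁ := by
    push_cast; module
  have hτp : (ρ₀ + (t : ℂ) • (ρ₁ - ρ₀)).PosDef := by
    rw [e]
    have a1 : (((1 - t : ℝ) : ℂ) • ρ₀).PosSemidef := h0.1.smul (by
      have : (0:ℝ) ≤ 1 - t := by linarith
      exact_mod_cast this)
    have a2 : ((t : ℂ) • ρ₁).PosDef := hp1.smul (by exact_mod_cast ht)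
    exact Matrix.PosDef.posSemidef_add a1 a2
  have hτs : IsState (ρ₀ + (t : ℂ) • (ρ₁ - ρ₀)) := by
    refine ⟨hτp.posSemidef, ?_⟩
    rw [Matrix.trace_add, Matrix.trace_smul, Matrix.trace_sub, h0.2, h1.2]; simp
  refine ⟨_, rfl, hτs, hτp, ?_⟩
  have k0 := relEnt_nonneg h0 hτs hτp
  have k1 := relEnt_nonneg h1 hτs hτp
  have hsum : (1 - t) * relEnt ρ₀ σ + t * relEnt ρ₁ σ =
      (1 - t) * relEnt ρ₀ (ρ₀ + (t : ℂ) • (ρ₁ - ρ₀)) + t * relEnt ρ₁ (ρ₀ + (t : ℂ) • (ρ₁ - ρ₀)) +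
        relEnt (ρ₀ + (t : ℂ) • (ρ₁ - ρ₀)) σ := by
    generalize hτ : ρ₀ + (t : ℂ) • (ρ₁ - ρ₀) = τ at *
    unfold relEnt
    have : (Matrix.trace (τ * (matLog τ - matLog σ))).re =
        (1 - t) * (Matrix.trace (ρ₀ * (matLog τ - matLog σ))).re +
        t * (Matrix.trace (ρ₁ * (matLog τ - matLog σ))).re := by
      generalize matLog τ - matLog σ = M
      rw [e, Matrix.add_mul, Matrix.smul_mul, Matrix.smul_mul, Matrix.trace_add,
        Matrix.trace_smul, Matrix.trace_smul, smul_eq_mul, smul_eq_mul, Complex.add_re,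
        Complex.re_ofReal_mul, Complex.re_ofReal_mul]
    rw [this]
    simp only [Matrix.mul_sub, Matrix.trace_sub, Complex.sub_re]
    ring
  have : 0 ≤ (1 - t) * relEnt ρ₀ (ρ₀ + (t : ℂ) • (ρ₁ - ρ₀)) := mul_nonneg (by linarith) k0
  have : 0 ≤ t * relEnt ρ₁ (ρ₀ + (t : ℂ) • (ρ₁ - ρ₀)) := mul_nonneg ht.le k1
  linarith

end Helpers

section Local
variable {ι : Type*} [Fintype ι] [DecidableEq ι] {d : ι → Type*}
  [∀ i, Fintype (d i)] [∀ i, DecidableEq (d i)]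

/-- glue configurations on `A` and its complement -/
def glue (A : Finset ι) (z : ∀ j : {j : ι // j ∈ A}, d j.1) (x : ∀ j : {j : ι // j ∉ A}, d j.1) :
    ∀ j, d j := fun j => if h : j ∈ A then z ⟨j, h⟩ else x ⟨j, h⟩

lemma glue_inj (A : Finset ι) {z z' : ∀ j : {j : ι // j ∈ A}, d j.1}
    {x x' : ∀ j : {j : ι // j ∉ A}, d j.1} (h : glue A z x = glue A z' x') : z = z' ∧ x = x' := by
  constructor
  · funext j
    have := congrFun h j.1
    simpa [glue, j.2] using this
  · funext j
    have := congrFun h j.1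
    simpa [glue, j.2] using this

lemma sum_glue {M : Type*} [AddCommMonoid M] (A : Finset ι) (f : (∀ j, d j) → M) :
    ∑ x, f x = ∑ z : ∀ j : {j : ι // j ∈ A}, d j.1, ∑ x : ∀ j : {j : ι // j ∉ A}, d j.1,
      f (glue A z x) := by
  rw [← Fintype.sum_prod_type']
  exact ((Equiv.piEquivPiSubtypeProd (fun j => j ∈ A) d).symm.sum_comp f).symm

/-- replace the configuration on `A` by the reference one -/
def pin (a : ∀ j, d j) (A : Finset ι) (x : ∀ j, d j) : ∀ j, d j :=
  fun j => if j ∈ A then a j else x j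

/-- the unital completely positive map `X ↦ 1_A ⊗ ⟨a|_A X |a⟩_A` -/
def cmp (a : ∀ j, d j) (A : Finset ι) (X : Matrix (∀ j, d j) (∀ j, d j) ℂ) :
    Matrix (∀ j, d j) (∀ j, d j) ℂ :=
  fun x y => if (∀ j ∈ A, x j = y j) then X (pin a A x) (pin a A y) else 0

lemma pin_glue (a : ∀ j, d j) (A : Finset ι) (z : ∀ j : {j : ι // j ∈ A}, d j.1)
    (x : ∀ j : {j : ι // j ∉ A}, d j.1) : pin a A (glue A z x) = glue A (fun j => a j.1) x := by
  funext j
  by_cases h : j ∈ A <;> simp [pin, glue, h]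

lemma cmp_glue (a : ∀ j, d j) (A : Finset ι) (X : Matrix (∀ j, d j) (∀ j, d j) ℂ)
    (z z' : ∀ j : {j : ι // j ∈ A}, d j.1) (x x' : ∀ j : {j : ι // j ∉ A}, d j.1) :
    cmp a A X (glue A z x) (glue A z' x') =
      if z = z' then X (glue A (fun j => a j.1) x) (glue A (fun j => a j.1) x') else 0 := by
  unfold cmp
  rw [pin_glue, pin_glue]
  congr 1
  apply propext
  constructor
  · intro h
    funext j
    have := h j.1 j.2
    simpa [glue, j.2] using this
  · rintro rfl j hj
    simp [glue, hj]

lemma cmp_sub (a : ∀ j, d j) (A : Finset ι) (X Y : Matrix (∀ j, d j) (∀ j, d j) ℂ) :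
    cmp a A (X - Y) = cmp a A X - cmp a A Y := by
  ext x y
  simp only [cmp, Matrix.sub_apply]
  split_ifs <;> simp

lemma cmp_empty (a : ∀ j, d j) (X : Matrix (∀ j, d j) (∀ j, d j) ℂ) : cmp a ∅ X = X := by
  ext x y
  have : ∀ x, pin a ∅ x = x := fun x => by funext j; simp [pin]
  simp [cmp, this]

lemma cmp_insert (a : ∀ j, d j) {A : Finset ι} {i : ι} (hi : i ∉ A)
    (X : Matrix (∀ j, d j) (∀ j, d j) ℂ) : cmp a (insert i A) X = cmp a {i} (cmp a A X) := by
  ext x y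
  have hpin : ∀ x : ∀ j, d j, pin a A (pin a {i} x) = pin a (insert i A) x := by
    intro x; funext j
    by_cases h : j ∈ A
    · simp [pin, h]
    · simp [pin, h]
  have hA : ∀ j ∈ A, ∀ x : ∀ j, d j, pin a {i} x j = x j := by
    intro j hj x
    have : j ≠ i := by rintro rfl; exact hi hj
    simp [pin, this]
  simp only [cmp, hpin]
  by_cases h1 : x i = y i
  · by_cases h2 : ∀ j ∈ A, x j = y j
    · rw [if_pos, if_pos, if_pos]
      · intro j hj; rw [hA j hj, hA j hj, h2 j hj]
      · simpa using h1
      · simpa using ⟨h1, h2⟩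
    · rw [if_neg, if_pos, if_neg]
      · intro h; apply h2; intro j hj; have := h j hj; rwa [hA j hj, hA j hj] at this
      · simpa using h1
      · intro h; exact h2 fun j hj => h j (Finset.mem_insert_of_mem hj)
  · rw [if_neg, if_neg]
    · simpa using h1
    · intro h; exact h1 (h i (Finset.mem_insert_self _ _))

lemma cmp_embedAt (a : ∀ j, d j) (i : ι)
    (M : Matrix (∀ j : {j : ι // j ≠ i}, d j.1) (∀ j : {j : ι // j ≠ i}, d j.1) ℂ) :
    cmp a {i} (embedAt i M) = embedAt i M := by
  ext x y
  have hr : ∀ x : ∀ j, d j, (fun j : {j : ι // j ≠ i} => pin a {i} x j.1) =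
      fun j : {j : ι // j ≠ i} => x j.1 := by
    intro x; funext j; simp [pin, j.2]
  by_cases h : x i = y i
  · simp only [cmp, embedAt, hr]
    rw [if_pos (by simpa using h), if_pos (by simp [pin]), if_pos h]
  · simp only [cmp, embedAt]
    rw [if_neg (by simpa using h), if_neg h]

lemma trace_cmp (a : ∀ j, d j) (A : Finset ι) (H Z : Matrix (∀ j, d j) (∀ j, d j) ℂ)
    (hZ : ptraceSet A Z = 0) : Matrix.trace (cmp a A H * Z) = 0 := by
  have hZ' : ∀ x y, ∑ z : ∀ j : {j : ι // j ∈ A}, d j.1, Z (glue A z x) (glue A z y) = 0 := by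
    intro x y
    exact congrFun (congrFun hZ x) y
  simp only [Matrix.trace, Matrix.diag, Matrix.mul_apply]
  rw [sum_glue A]
  simp_rw [sum_glue A (fun y => cmp a A H _ y * Z y _), cmp_glue]
  simp only [ite_mul, zero_mul]
  have : ∀ (z : ∀ j : {j : ι // j ∈ A}, d j.1) (x : ∀ j : {j : ι // j ∉ A}, d j.1),
    (∑ z' : ∀ j : {j : ι // j ∈ A}, d j.1, ∑ x' : ∀ j : {j : ι // j ∉ A}, d j.1,
      if z = z' then H (glue A (fun j => a j.1) x) (glue A (fun j => a j.1) x') *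
        Z (glue A z' x') (glue A z x) else 0) =
      ∑ x' : ∀ j : {j : ι // j ∉ A}, d j.1,
        H (glue A (fun j => a j.1) x) (glue A (fun j => a j.1) x') *
        Z (glue A z x') (glue A z x) := by
    intro z x
    rw [Finset.sum_eq_single z]
    · simp
    · intro b _ hb
      simp [Ne.symm hb]
    · simp
  simp_rw [this]
  rw [Finset.sum_comm]
  refine Finset.sum_eq_zero fun x _ => ?_
  rw [Finset.sum_comm]
  refine Finset.sum_eq_zero fun x' _ => ?_
  rw [← Finset.mul_sum, hZ', mul_zero]

section
open scoped Matrix.Norms.L2Operator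

lemma norm_mulVec_sq {n : Type*} [Fintype n] [DecidableEq n] (X : Matrix n n ℂ) (v : n → ℂ) :
    ∑ x, ‖∑ y, X x y * v y‖ ^ 2 ≤ ‖X‖ ^ 2 * ∑ y, ‖v y‖ ^ 2 := by
  have h := Matrix.l2_opNorm_mulVec X (WithLp.toLp 2 v)
  have h2 := pow_le_pow_left₀ (norm_nonneg _) h 2
  rw [mul_pow, EuclideanSpace.norm_sq_eq, EuclideanSpace.norm_sq_eq] at h2
  exact h2

lemma norm_le_of_mulVec_sq {n : Type*} [Fintype n] [DecidableEq n] (X : Matrix n n ℂ) (c : ℝ)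
    (hc : 0 ≤ c) (h : ∀ v : n → ℂ, ∑ x, ‖∑ y, X x y * v y‖ ^ 2 ≤ c ^ 2 * ∑ y, ‖v y‖ ^ 2) :
    ‖X‖ ≤ c := by
  rw [← Matrix.l2_opNorm_toEuclideanCLM]
  refine ContinuousLinearMap.opNorm_le_bound _ hc fun v => ?_
  refine (sq_le_sq₀ (by positivity) (by positivity)).mp ?_
  rw [mul_pow, EuclideanSpace.norm_sq_eq, EuclideanSpace.norm_sq_eq]
  exact h v

lemma norm_cmp_le (a : ∀ j, d j) (A : Finset ι) (X : Matrix (∀ j, d j) (∀ j, d j) ℂ) :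
    ‖cmp a A X‖ ≤ ‖X‖ := by
  refine norm_le_of_mulVec_sq _ _ (norm_nonneg _) fun v => ?_
  rw [sum_glue A (fun y => ‖v y‖ ^ 2), sum_glue A, Finset.mul_sum]
  refine Finset.sum_le_sum fun z _ => ?_
  set az : ∀ j : {j : ι // j ∈ A}, d j.1 := fun j => a j.1 with haz
  -- the vector supported on the reference configuration
  set u : (∀ j, d j) → ℂ := fun y =>
    if (fun j : {j : ι // j ∈ A} => y j.1) = az then v (glue A z (fun j => y j.1)) else 0 with hu
  have hug : ∀ w y, u (glue A w y) = if w = az then v (glue A z y) else 0 := by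
    intro w y
    have e1 : (fun j : {j : ι // j ∈ A} => glue A w y j.1) = w := by
      funext j; simp [glue, j.2]
    have e2 : (fun j : {j : ι // j ∉ A} => glue A w y j.1) = y := by
      funext j; simp [glue, j.2]
    simp only [hu]
    rw [e1, e2]
  have h1 := norm_mulVec_sq X u
  have e3 : ∀ x', ∑ y, X x' y * u y = ∑ y, X x' (glue A az y) * v (glue A z y) := by
    intro x'
    rw [sum_glue A, Finset.sum_eq_single az]
    · simp [hug]
    · intro b _ hb
      simp [hug, hb]
    · simp
  have e4 : ∑ y, ‖u y‖ ^ 2 = ∑ y, ‖v (glue A z y)‖ ^ 2 := by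
    rw [sum_glue A, Finset.sum_eq_single az]
    · simp [hug]
    · intro b _ hb
      simp [hug, hb]
    · simp
  have e5 : ∀ x, ∑ y, cmp a A X (glue A z x) y * v y =
      ∑ y, X (glue A az x) (glue A az y) * v (glue A z y) := by
    intro x
    rw [sum_glue A, Finset.sum_eq_single z]
    · simp [cmp_glue, haz]
    · intro b _ hb
      simp [cmp_glue, Ne.symm hb]
    · simp
  simp only [e3] at h1
  rw [e4] at h1
  simp only [e5]
  refine le_trans ?_ h1
  rw [sum_glue A]
  exact Finset.single_le_sum (f := fun w => ∑ x, ‖∑ y, X (glue A w x) (glue A az y) * v (glue A z y)‖ ^ 2)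
    (fun w _ => Finset.sum_nonneg fun x _ => by positivity) (Finset.mem_univ az)

lemma norm_sub_cmp_single (a : ∀ j, d j) (i : ι) {H : Matrix (∀ j, d j) (∀ j, d j) ℂ}
    (hH : lipNorm H ≤ 1) : ‖H - cmp a {i} H‖ ≤ 1 := by
  have h1 : (⨅ M : Matrix (∀ j : {j : ι // j ≠ i}, d j.1) (∀ j : {j : ι // j ≠ i}, d j.1) ℂ,
    opNorm (H - embedAt i M)) ≤ 1 / 2 := by
    have := le_ciSup (f := fun i : ι => ⨅ M : Matrix (∀ j : {j : ι // j ≠ i}, d j.1)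
      (∀ j : {j : ι // j ≠ i}, d j.1) ℂ, opNorm (H - embedAt i M)) (Set.finite_range _).bddAbove i
    unfold lipNorm at hH
    linarith
  refine le_of_forall_pos_le_add fun ε hε => ?_
  obtain ⟨M, hM⟩ := exists_lt_of_ciInf_lt (lt_of_le_of_lt h1 (by linarith : (1:ℝ)/2 < 1/2 + ε/2))
  rw [opNorm_eq] at hM
  have e : H - cmp a {i} H = (H - embedAt i M) - cmp a {i} (H - embedAt i M) := by
    rw [cmp_sub, cmp_embedAt]; abel
  rw [e]
  refine (norm_sub_le _ _).trans ?_
  have := norm_cmp_le a {i} (H - embedAt i M)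
  linarith

lemma norm_sub_cmp (a : ∀ j, d j) (A : Finset ι) {H : Matrix (∀ j, d j) (∀ j, d j) ℂ}
    (hH : lipNorm H ≤ 1) : ‖H - cmp a A H‖ ≤ A.card := by
  induction A using Finset.induction_on with
  | empty => simp [cmp_empty]
  | insert i A hi ih =>
    rw [cmp_insert a hi, Finset.card_insert_of_notMem hi]
    have e : H - cmp a {i} (cmp a A H) = (H - cmp a {i} H) + cmp a {i} (H - cmp a A H) := by
      rw [cmp_sub]; abel
    rw [e]
    refine (norm_add_le _ _).trans ?_
    have h1 := norm_sub_cmp_single a i hH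
    have h2 := norm_cmp_le a {i} (H - cmp a A H)
    push_cast
    linarith

end

/-- local transport cost estimate -/
lemma local_transport (a : ∀ j, d j) (A : Finset ι) {H : Matrix (∀ j, d j) (∀ j, d j) ℂ}
    (hH : lipNorm H ≤ 1) {ρ τ : Matrix (∀ j, d j) (∀ j, d j) ℂ} (hρ : IsState ρ) (hτ : IsState τ)
    (hp : τ.PosDef) (hA : ptraceSet A (ρ - τ) = 0) :
    |(Matrix.trace (H * (ρ - τ))).re| ≤ A.card * √(2 * relEnt ρ τ) := by
  have h := pinsker hρ hτ hp (H - cmp a A H) (c := A.card) (norm_sub_cmp a A hH)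
  rwa [Matrix.sub_mul, Matrix.trace_sub, trace_cmp a A H _ hA, sub_zero] at h

lemma ptraceSet_sub (A : Finset ι) (X Y : Matrix (∀ j, d j) (∀ j, d j) ℂ) :
    ptraceSet A (X - Y) = ptraceSet A X - ptraceSet A Y := by
  ext x y
  simp [ptraceSet, Finset.sum_sub_distrib]

lemma ptraceSet_univ (X : Matrix (∀ j, d j) (∀ j, d j) ℂ) (hX : X.trace = 0) :
    ptraceSet Finset.univ X = 0 := by
  ext x y
  have : IsEmpty {j : ι // j ∉ Finset.univ} := ⟨fun j => j.2 (Finset.mem_univ _)⟩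
  have hxy : x = y := Subsingleton.elim _ _
  subst hxy
  rw [Matrix.trace, sum_glue Finset.univ] at hX
  have : ∀ z, ∑ x' : ∀ j : {j : ι // j ∉ Finset.univ}, d j.1,
      X.diag (glue Finset.univ z x') = X.diag (glue Finset.univ z x) := by
    intro z
    rw [Finset.sum_eq_single x]
    · intro b _ hb; exact absurd (Subsingleton.elim _ _) hb
    · intro h; exact absurd (Finset.mem_univ _) h
  simp only [this] at hX
  exact hX

end Local

lemma scalar_step {N x D m t : ℝ} (hN : 1 ≤ N) (hx : 0 < x) (hm : 0 ≤ m) (hD : x ≤ N * D)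
    (ht : t = min 1 (x / D)) :
    0 ≤ x - t * D ∧ x - t * D ≤ (1 - 1 / N) * x ∧ 0 < t ∧ t ≤ 1 ∧
      t * (m * √(2 * D)) ≤ 2 * m * √(2 * N) * (√x - √(x - t * D)) := by
  have hN0 : 0 < N := by linarith
  have hD0 : 0 < D := by
    by_contra h
    push Not at h
    nlinarith
  have ht0 : 0 < t := by rw [ht]; exact lt_min one_pos (div_pos hx hD0)
  have ht1 : t ≤ 1 := by rw [ht]; exact min_le_left _ _
  have htD : t * D ≤ x := by
    have : t ≤ x / D := by rw [ht]; exact min_le_right _ _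
    rwa [le_div_iff₀ hD0] at this
  have hxN : x / N ≤ D := by rw [div_le_iff₀ hN0]; linarith
  refine ⟨by linarith, ?_, ht0, ht1, ?_⟩
  · have : x / N ≤ t * D := by
      rcases min_choice 1 (x / D) with h | h
      · rw [ht, h, one_mul]; exact hxN
      · rw [ht, h, div_mul_cancel₀ _ hD0.ne']
        exact div_le_self hx.le hN
    have e : (1 - 1 / N) * x = x - x / N := by ring
    rw [e]; linarith
  · have hsx := Real.sqrt_pos.2 hx
    set y := x - t * D with hy
    have hy0 : 0 ≤ y := by linarith
    have hyx : √y ≤ √x := Real.sqrt_le_sqrt (by nlinarith)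
    have hsy := Real.sqrt_nonneg y
    have h1 : (√x - √y) * (√x + √y) = t * D := by
      have a1 := Real.mul_self_sqrt hx.le
      have a2 := Real.mul_self_sqrt hy0
      nlinarith
    have h2 : t * D ≤ (√x - √y) * (2 * √x) := by nlinarith
    have h3 : √x ≤ √N * √D := by
      rw [← Real.sqrt_mul hN0.le]; exact Real.sqrt_le_sqrt hD
    have hsD := Real.sqrt_pos.2 hD0
    have h4 : t * √D ≤ 2 * √N * (√x - √y) := by
      have b1 : D = √D * √D := (Real.mul_self_sqrt hD0.le).symm
      have b2 : t * √D * √D ≤ (2 * √N * (√x - √y)) * √D := by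
        calc t * √D * √D = t * D := by rw [mul_assoc, ← b1]
          _ ≤ (√x - √y) * (2 * √x) := h2
          _ ≤ (√x - √y) * (2 * (√N * √D)) := by
            have : 0 ≤ √x - √y := by linarith
            gcongr
          _ = _ := by ring
      exact le_of_mul_le_mul_right b2 hsD
    rw [Real.sqrt_mul (by norm_num), Real.sqrt_mul (by norm_num)]
    calc t * (m * (√2 * √D)) = m * √2 * (t * √D) := by ring
      _ ≤ m * √2 * (2 * √N * (√x - √y)) := by gcongr
      _ = _ := by ring

section Main
variable {Λ : Type*} [Fintype Λ] [DecidableEq Λ] {dloc : ℕ} {nA : ℕ}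
    {σ : Matrix (∀ _ : Λ, Fin dloc) (∀ _ : Λ, Fin dloc) ℂ}
    {E F : Fin nA → (Matrix (∀ _ : Λ, Fin dloc) (∀ _ : Λ, Fin dloc) ℂ →ₗ[ℂ]
      Matrix (∀ _ : Λ, Fin dloc) (∀ _ : Λ, Fin dloc) ℂ)}
    {Adel : Fin nA → Finset Λ} {c₂ : ℝ}

lemma step (hd : 0 < dloc) (hσpos : σ.PosDef)
    (hE : ∀ i, IsGNSCondExp σ (E i) (F i))
    (hloc : ∀ i X, ptraceSet (Adel i) (E i X) = ptraceSet (Adel i) X)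
    (hAT : ∀ ρ, IsState ρ → relEnt ρ σ ≤ (∑ i, relEnt ρ (E i ρ)) + c₂)
    {H : Matrix (∀ _ : Λ, Fin dloc) (∀ _ : Λ, Fin dloc) ℂ} (hH : lipNorm H ≤ 1)
    {m : ℝ} (hm : ∀ i, ((Adel i).card : ℝ) ≤ m) (hm0 : 0 ≤ m) (hn : 0 < nA)
    {ρ : Matrix (∀ _ : Λ, Fin dloc) (∀ _ : Λ, Fin dloc) ℂ} (hρ : IsState ρ) (hρp : ρ.PosDef)
    (hx : 0 < relEnt ρ σ - c₂) :
    ∃ ρ' : Matrix (∀ _ : Λ, Fin dloc) (∀ _ : Λ, Fin dloc) ℂ, IsState ρ' ∧ ρ'.PosDef ∧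
      relEnt ρ' σ - c₂ ≤ (1 - 1 / (nA : ℝ)) * (relEnt ρ σ - c₂) ∧
      (Matrix.trace (H * ρ)).re ≤ (Matrix.trace (H * ρ')).re +
        2 * m * √(2 * nA) * (√(relEnt ρ σ - c₂) - √(relEnt ρ' σ - c₂)) := by
  have hN : (1 : ℝ) ≤ nA := by exact_mod_cast hn
  obtain ⟨i, hi⟩ : ∃ i, relEnt ρ σ - c₂ ≤ nA * relEnt ρ (E i ρ) := by
    by_contra hcon
    push Not at hcon
    have hne : (Finset.univ : Finset (Fin nA)).Nonempty := ⟨⟨0, hn⟩, Finset.mem_univ _⟩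
    have := Finset.sum_lt_sum_of_nonempty hne (fun i _ => hcon i)
    rw [← Finset.mul_sum, Finset.sum_const, Finset.card_univ, Fintype.card_fin, nsmul_eq_mul] at this
    have := lt_of_mul_lt_mul_left this (by linarith)
    have := hAT ρ hρ
    linarith
  have hωp := E_posDef (hE i) hσpos hρp
  have hω : IsState (E i ρ) := ⟨hωp.posSemidef, by rw [(hE i).tracePreserving, hρ.2]⟩
  obtain ⟨t, ht⟩ : ∃ t, t = min 1 ((relEnt ρ σ - c₂) / relEnt ρ (E i ρ)) := ⟨_, rfl⟩
  obtain ⟨s1, s2, s3, s4, s5⟩ := scalar_step hN hx hm0 hi ht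
  obtain ⟨τ, eτ, hτ, hτp, hτD⟩ := relEnt_convex (σ := σ) hρ hω hωp s3 s4
  have hchain := relEnt_chain (hE i) hσpos hρp
  have hτD' : relEnt τ σ - c₂ ≤ relEnt ρ σ - c₂ - t * relEnt ρ (E i ρ) := by
    have : (1 - t) * relEnt ρ σ + t * relEnt (E i ρ) σ = relEnt ρ σ - t * relEnt ρ (E i ρ) := by
      rw [hchain]; ring
    linarith
  refine ⟨τ, hτ, hτp, hτD'.trans s2, ?_⟩
  have hpt : ptraceSet (Adel i) (ρ - E i ρ) = 0 := by
    rw [ptraceSet_sub, hloc, sub_self]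
  have hl := local_transport (fun _ => (⟨0, hd⟩ : Fin dloc)) (Adel i) hH hρ hω hωp hpt
  have hl2 : (Matrix.trace (H * (ρ - E i ρ))).re ≤ m * √(2 * relEnt ρ (E i ρ)) :=
    (le_abs_self _).trans (hl.trans (mul_le_mul_of_nonneg_right (hm i) (Real.sqrt_nonneg _)))
  have hlin : (Matrix.trace (H * ρ)).re = (Matrix.trace (H * τ)).re +
      t * (Matrix.trace (H * (ρ - E i ρ))).re := by
    rw [eτ, Matrix.mul_add, Matrix.mul_smul, Matrix.trace_add, Matrix.trace_smul, smul_eq_mul,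
      Complex.add_re, Complex.re_ofReal_mul, Matrix.mul_sub, Matrix.mul_sub, Matrix.trace_sub,
      Matrix.trace_sub, Complex.sub_re, Complex.sub_re]
    ring
  have hsq : √(relEnt τ σ - c₂) ≤ √(relEnt ρ σ - c₂ - t * relEnt ρ (E i ρ)) :=
    Real.sqrt_le_sqrt hτD'
  have h6 : t * (Matrix.trace (H * (ρ - E i ρ))).re ≤ t * (m * √(2 * relEnt ρ (E i ρ))) := by
    gcongr
  have h7 : 2 * m * √(2 * nA) * (√(relEnt ρ σ - c₂) - √(relEnt ρ σ - c₂ - t * relEnt ρ (E i ρ))) ≤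
      2 * m * √(2 * nA) * (√(relEnt ρ σ - c₂) - √(relEnt τ σ - c₂)) := by
    gcongr
  linarith

lemma main_posDef (hd : 0 < dloc) (hσ : IsState σ) (hσpos : σ.PosDef)
    (hE : ∀ i, IsGNSCondExp σ (E i) (F i))
    (hloc : ∀ i X, ptraceSet (Adel i) (E i X) = ptraceSet (Adel i) X)
    (hc₂ : 0 ≤ c₂)
    (hAT : ∀ ρ, IsState ρ → relEnt ρ σ ≤ (∑ i, relEnt ρ (E i ρ)) + c₂)
    {H : Matrix (∀ _ : Λ, Fin dloc) (∀ _ : Λ, Fin dloc) ℂ} (hH : lipNorm H ≤ 1)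
    {m : ℝ} (hm : ∀ i, ((Adel i).card : ℝ) ≤ m) (hm0 : 0 ≤ m)
    {ρ : Matrix (∀ _ : Λ, Fin dloc) (∀ _ : Λ, Fin dloc) ℂ} (hρ : IsState ρ) (hρp : ρ.PosDef) :
    (Matrix.trace (H * (ρ - σ))).re ≤ 2 * m * √(2 * nA) * √(relEnt ρ σ) +
      (Fintype.card Λ : ℝ) * √(2 * c₂) := by
  have hglob : ∀ τ : Matrix (∀ _ : Λ, Fin dloc) (∀ _ : Λ, Fin dloc) ℂ, IsState τ →
      (Matrix.trace (H * (τ - σ))).re ≤ (Fintype.card Λ : ℝ) * √(2 * relEnt τ σ) := by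
    intro τ hτ
    have := local_transport (fun _ => (⟨0, hd⟩ : Fin dloc)) Finset.univ hH hτ hσ hσpos
      (ptraceSet_univ _ (by rw [Matrix.trace_sub, hτ.2, hσ.2, sub_self]))
    exact (le_abs_self _).trans this
  rcases Nat.eq_zero_or_pos nA with h0 | hn
  · subst h0
    have h1 := hAT ρ hρ
    simp only [Finset.univ_eq_empty, Finset.sum_empty, zero_add] at h1
    have h2 : 0 ≤ 2 * m * √(2 * ((0 : ℕ) : ℝ)) * √(relEnt ρ σ) := by positivity
    have h3 : (Fintype.card Λ : ℝ) * √(2 * relEnt ρ σ) ≤ (Fintype.card Λ : ℝ) * √(2 * c₂) := by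
      gcongr
    linarith [hglob ρ hρ]
  have hN : (1 : ℝ) ≤ nA := by exact_mod_cast hn
  set r : ℝ := 1 - 1 / (nA : ℝ) with hr
  have hr0 : 0 ≤ r := by
    have : 1 / (nA : ℝ) ≤ 1 := by rw [div_le_one (by linarith)]; exact hN
    linarith
  have hr1 : r < 1 := by
    have : 0 < 1 / (nA : ℝ) := by positivity
    linarith
  set X : ℝ := max (relEnt ρ σ - c₂) 0 with hX
  have hX0 : 0 ≤ X := le_max_right _ _
  have iter : ∀ k : ℕ, ∃ τ : Matrix (∀ _ : Λ, Fin dloc) (∀ _ : Λ, Fin dloc) ℂ, IsState τ ∧ τ.PosDef ∧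
      relEnt τ σ - c₂ ≤ r ^ k * X ∧
      (Matrix.trace (H * ρ)).re ≤ (Matrix.trace (H * τ)).re +
        2 * m * √(2 * nA) * (√(relEnt ρ σ - c₂) - √(relEnt τ σ - c₂)) := by
    intro k
    induction k with
    | zero => exact ⟨ρ, hρ, hρp, by simp [hX], by simp⟩
    | succ k ih =>
      obtain ⟨τ, h1, h2, h3, h4⟩ := ih
      rcases le_or_gt (relEnt τ σ - c₂) 0 with hle | hlt
      · exact ⟨τ, h1, h2, hle.trans (by positivity), h4⟩
      · obtain ⟨τ', g1, g2, g3, g4⟩ := step hd hσpos hE hloc hAT hH hm hm0 hn h1 h2 hlt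
        refine ⟨τ', g1, g2, g3.trans ?_, ?_⟩
        · rw [pow_succ', mul_assoc]
          gcongr
        · linarith
  have bound : ∀ k : ℕ, (Matrix.trace (H * (ρ - σ))).re ≤ 2 * m * √(2 * nA) * √(relEnt ρ σ) +
      (Fintype.card Λ : ℝ) * √(2 * (c₂ + r ^ k * X)) := by
    intro k
    obtain ⟨τ, h1, h2, h3, h4⟩ := iter k
    have h5 := hglob τ h1
    rw [Matrix.mul_sub, Matrix.trace_sub, Complex.sub_re] at h5 ⊢
    have h6 : (Fintype.card Λ : ℝ) * √(2 * relEnt τ σ) ≤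
        (Fintype.card Λ : ℝ) * √(2 * (c₂ + r ^ k * X)) := by
      gcongr; linarith
    have h7 : 2 * m * √(2 * nA) * (√(relEnt ρ σ - c₂) - √(relEnt τ σ - c₂)) ≤
        2 * m * √(2 * nA) * √(relEnt ρ σ) := by
      have : √(relEnt ρ σ - c₂) ≤ √(relEnt ρ σ) := Real.sqrt_le_sqrt (by linarith)
      have := Real.sqrt_nonneg (relEnt τ σ - c₂)
      gcongr
      linarith
    linarith
  have lim : Filter.Tendsto (fun k : ℕ => 2 * m * √(2 * nA) * √(relEnt ρ σ) +
      (Fintype.card Λ : ℝ) * √(2 * (c₂ + r ^ k * X))) Filter.atTop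
      (nhds (2 * m * √(2 * nA) * √(relEnt ρ σ) + (Fintype.card Λ : ℝ) * √(2 * (c₂ + 0 * X)))) := by
    have := tendsto_pow_atTop_nhds_zero_of_lt_one hr0 hr1
    exact (((this.mul_const X).const_add c₂).const_mul 2).sqrt.const_mul _ |>.const_add _
  rw [zero_mul, add_zero] at lim
  exact ge_of_tendsto' lim bound

lemma main_state (hd : 0 < dloc) (hσ : IsState σ) (hσpos : σ.PosDef)
    (hE : ∀ i, IsGNSCondExp σ (E i) (F i))
    (hloc : ∀ i X, ptraceSet (Adel i) (E i X) = ptraceSet (Adel i) X)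
    (hc₂ : 0 ≤ c₂)
    (hAT : ∀ ρ, IsState ρ → relEnt ρ σ ≤ (∑ i, relEnt ρ (E i ρ)) + c₂)
    {H : Matrix (∀ _ : Λ, Fin dloc) (∀ _ : Λ, Fin dloc) ℂ} (hH : lipNorm H ≤ 1)
    {m : ℝ} (hm : ∀ i, ((Adel i).card : ℝ) ≤ m) (hm0 : 0 ≤ m)
    {ρ : Matrix (∀ _ : Λ, Fin dloc) (∀ _ : Λ, Fin dloc) ℂ} (hρ : IsState ρ) :
    (Matrix.trace (H * (ρ - σ))).re ≤ 2 * m * √(2 * nA) * √(relEnt ρ σ) +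
      (Fintype.card Λ : ℝ) * √(2 * c₂) := by
  set B := 2 * m * √(2 * nA) * √(relEnt ρ σ) + (Fintype.card Λ : ℝ) * √(2 * c₂) with hB
  have hB0 : 0 ≤ B := by positivity
  have hD0 := relEnt_nonneg hρ hσ hσpos
  have hss : relEnt σ σ = 0 := by simp [relEnt]
  have key : ∀ t : ℝ, 0 < t → t ≤ 1 → (1 - t) * (Matrix.trace (H * (ρ - σ))).re ≤ B := by
    intro t h0 h1
    obtain ⟨τ, eτ, hτ, hτp, hτD⟩ := relEnt_convex (σ := σ) hρ hσ hσpos h0 h1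
    have h := main_posDef hd hσ hσpos hE hloc hc₂ hAT hH hm hm0 hτ hτp
    have e : τ - σ = ((1 - t : ℝ) : ℂ) • (ρ - σ) := by
      rw [eτ]; push_cast; module
    rw [e, Matrix.mul_smul, Matrix.trace_smul, smul_eq_mul, Complex.re_ofReal_mul] at h
    have hle : relEnt τ σ ≤ relEnt ρ σ := by
      rw [hss] at hτD
      nlinarith
    refine h.trans ?_
    rw [hB]
    gcongr
  by_contra hcon
  push Not at hcon
  set f := (Matrix.trace (H * (ρ - σ))).re with hf
  have hf0 : 0 < f := lt_of_le_of_lt hB0 hcon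
  have hk := key ((f - B) / (2 * f)) (div_pos (by linarith) (by linarith))
    (by rw [div_le_one (by linarith)]; linarith)
  have e : (1 - (f - B) / (2 * f)) * f = f - (f - B) / 2 := by field_simp
  rw [e] at hk
  linarith

end Main

/-- **Weak transport cost inequality.** Suppose `{E i}` are Davies conditional expectations on
a lattice `Λ` of qudits with common full-rank invariant Gibbs state `σ`, each acting
nontrivially only on the enlarged region `A_i∂` (expressed by the fact that the partial trace
over `A_i∂` intertwines `E i` with the identity), and suppose the approximate tensorization
`D(ρ‖σ) ≤ Σᵢ D(ρ‖E_i(ρ)) + c₂` holds for all states `ρ`.  Then for all states `ρ`,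
`‖ρ − σ‖_{W₁} ≤ 2√2·(maxᵢ|A_i∂|)·√(n_A·D(ρ‖σ)) + |Λ|·√(2c₂)`. -/
theorem stmt9 {Λ : Type*} [Fintype Λ] [DecidableEq Λ] [Nonempty Λ] {dloc : ℕ} (hd : 0 < dloc)
    {nA : ℕ}
    (σ : Matrix (∀ _ : Λ, Fin dloc) (∀ _ : Λ, Fin dloc) ℂ) (hσ : IsState σ) (hσpos : σ.PosDef)
    (E F : Fin nA → (Matrix (∀ _ : Λ, Fin dloc) (∀ _ : Λ, Fin dloc) ℂ →ₗ[ℂ]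
      Matrix (∀ _ : Λ, Fin dloc) (∀ _ : Λ, Fin dloc) ℂ))
    (Adel : Fin nA → Finset Λ)
    (hE : ∀ i, IsGNSCondExp σ (E i) (F i))
    (hloc : ∀ i X, ptraceSet (Adel i) (E i X) = ptraceSet (Adel i) X)
    (c₂ : ℝ) (hc₂ : 0 ≤ c₂)
    (hAT : ∀ ρ, IsState ρ → relEnt ρ σ ≤ (∑ i, relEnt ρ (E i ρ)) + c₂) :
    ∀ ρ, IsState ρ →
      w1Norm (ρ - σ) ≤
        2 * Real.sqrt 2 * ((Finset.univ.sup (fun i => (Adel i).card) : ℕ) : ℝ) *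
            Real.sqrt (nA * relEnt ρ σ)
          + (Fintype.card Λ : ℝ) * Real.sqrt (2 * c₂) := by
  intro ρ hρ
  have hD0 := relEnt_nonneg hρ hσ hσpos
  refine Real.sSup_le ?_ (by positivity)
  rintro _ ⟨H, -, hH, rfl⟩
  refine (main_state hd hσ hσpos hE hloc hc₂ hAT hH
    (m := ((Finset.univ.sup (fun i => (Adel i).card) : ℕ) : ℝ)) ?_ (by positivity) hρ).trans
    (le_of_eq ?_)
  · intro i
    exact_mod_cast Finset.le_sup (f := fun i => (Adel i).card) (Finset.mem_univ i)
  · congr 1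
    rw [Real.sqrt_mul (by norm_num), Real.sqrt_mul (by positivity)]
    ring

end Paper
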